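/- arXiv:2002.11146 — 5 statements merged into one kernel-verified Lean document; each statement's English description precedes it below -/
import Mathlib

section
/- For every 1 ≤ r ≤ N−1 and every j ∈ {1,2,3,4}, the spectral norm of the commutator of the squared electric field with the hopping term satisfies ‖[E_r², T_r^(j)]‖ ≤ x·(Λ + 1/2). -/
open Matrix Complex

noncomputable section

/-- The spectral (ℓ²-operator) norm of a complex square matrix. -/
def specNorm {n : Type*} [Fintype n] [DecidableEq n] (M : Matrix n n ℂ) : ℝ :=
  ‖Matrix.toEuclideanCLM (𝕜 := ℂ) M‖

/-- Pauli X. -/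
def PX : Matrix (Fin 2) (Fin 2) ℂ := !![0, 1; 1, 0]
/-- Pauli Y. -/
def PY : Matrix (Fin 2) (Fin 2) ℂ := !![0, -I; I, 0]
/-- Pauli Z. -/
def PZ : Matrix (Fin 2) (Fin 2) ℂ := !![1, 0; 0, -1]

/-- Electric field operator `E |j⟩ = (j - Λ)|j⟩` on `ℂ^(2^η)`, `Λ = 2^(η-1)`. -/
def Eop (η : ℕ) : Matrix (Fin (2 ^ η)) (Fin (2 ^ η)) ℂ :=
  Matrix.diagonal fun j => ((j : ℕ) : ℂ) - ((2 ^ (η - 1) : ℕ) : ℂ)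

/-- Link operator `U |j⟩ = |j + 1 mod 2^η⟩`. -/
def Uop (η : ℕ) : Matrix (Fin (2 ^ η)) (Fin (2 ^ η)) ℂ :=
  Matrix.of fun j k => if (j : ℕ) = ((k : ℕ) + 1) % 2 ^ η then 1 else 0

/-- `A |j⟩ = |j XOR 1⟩`. -/
def Aop (η : ℕ) : Matrix (Fin (2 ^ η)) (Fin (2 ^ η)) ℂ :=
  Matrix.of fun j k => if (j : ℕ) = (k : ℕ) ^^^ 1 then 1 else 0

/-- `B |j⟩ = i (-1)^j |j XOR 1⟩`. -/
def Bop (η : ℕ) : Matrix (Fin (2 ^ η)) (Fin (2 ^ η)) ℂ :=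
  Matrix.of fun j k => if (j : ℕ) = (k : ℕ) ^^^ 1 then I * (-1) ^ (k : ℕ) else 0

/-- Configurations of the lattice: a qubit for each of the `N` sites (0-indexed; the paper's
site `r` is index `r - 1`) and a `2^η`-dimensional register for each of the `N - 1` links
(0-indexed; the paper's link `r` is index `r - 1`). -/
abbrev Config (N η : ℕ) := (Fin N → Fin 2) × (Fin (N - 1) → Fin (2 ^ η))

/-- Operators on the lattice Hilbert space `(ℂ²)^{⊗N} ⊗ (ℂ^{2Λ})^{⊗(N-1)}`. -/
abbrev LatOp (N η : ℕ) := Matrix (Config N η) (Config N η) ℂ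

/-- A single-qubit operator `M` acting on the `r`-th site factor. -/
def siteOp (N η : ℕ) (r : Fin N) (M : Matrix (Fin 2) (Fin 2) ℂ) : LatOp N η :=
  Matrix.of fun p q =>
    if p.2 = q.2 ∧ ∀ s, s ≠ r → p.1 s = q.1 s then M (p.1 r) (q.1 r) else 0

/-- A single-link operator `M` acting on the `r`-th link factor. -/
def linkOp (N η : ℕ) (r : Fin (N - 1)) (M : Matrix (Fin (2 ^ η)) (Fin (2 ^ η)) ℂ) :
    LatOp N η :=
  Matrix.of fun p q =>
    if p.1 = q.1 ∧ ∀ s, s ≠ r → p.2 s = q.2 s then M (p.2 r) (q.2 r) else 0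

/-- For the `r`-th link (0-indexed), the site on its left, as an index into `Fin N`. -/
def siteL {N : ℕ} (r : Fin (N - 1)) : Fin N := ⟨r.1, by have := r.2; omega⟩

/-- For the `r`-th link (0-indexed), the site on its right, as an index into `Fin N`. -/
def siteR {N : ℕ} (r : Fin (N - 1)) : Fin N := ⟨r.1 + 1, by have := r.2; omega⟩

/-- `X_r X_{r+1} + Y_r Y_{r+1}` (paper indices; `r` is the 0-indexed link). -/
def Gop (N η : ℕ) (r : Fin (N - 1)) : LatOp N η :=
  siteOp N η (siteL r) PX * siteOp N η (siteR r) PX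
    + siteOp N η (siteL r) PY * siteOp N η (siteR r) PY

/-- `X_r Y_{r+1} - Y_r X_{r+1}` (paper indices; `r` is the 0-indexed link). -/
def Gtilde (N η : ℕ) (r : Fin (N - 1)) : LatOp N η :=
  siteOp N η (siteL r) PX * siteOp N η (siteR r) PY
    - siteOp N η (siteL r) PY * siteOp N η (siteR r) PX

/-- The four hopping terms `T_r^(1), …, T_r^(4)` (`j = 0,…,3` is the paper's `j = 1,…,4`;
`r` is the 0-indexed link, the paper's site/link `r+1`). -/
def Thop (N η : ℕ) (x : ℝ) (r : Fin (N - 1)) : Fin 4 → LatOp N η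
  | 0 => ((x : ℂ) / 4) • (linkOp N η r (Aop η) * Gop N η r)
  | 1 => ((x : ℂ) / 4) • (linkOp N η r ((Uop η)ᴴ * Aop η * Uop η) * Gop N η r)
  | 2 => ((x : ℂ) / 4) • (linkOp N η r ((Uop η)ᴴ * Bop η * Uop η) * Gtilde N η r)
  | 3 => ((x : ℂ) / 4) • (linkOp N η r (Bop η) * Gtilde N η r)

/-- Mass term `D_r^(M) = -(μ/2) (-1)^r Z_r` at the 0-indexed site `i` (paper's site `r = i+1`). -/
def DM (N η : ℕ) (μ : ℝ) (i : Fin N) : LatOp N η :=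
  ((-(μ : ℂ) / 2) * (-1) ^ ((i : ℕ) + 1)) • siteOp N η i PZ

/-- Electric term `D_r^(E) = E_r²` at the 0-indexed link `r`. -/
def DE (N η : ℕ) (r : Fin (N - 1)) : LatOp N η := (linkOp N η r (Eop η)) ^ 2

/-- `D_r = D_r^(M) + D_r^(E)` for the paper's `1 ≤ r ≤ N - 1` (`r` the 0-indexed link). -/
def Dlink (N η : ℕ) (μ : ℝ) (r : Fin (N - 1)) : LatOp N η :=
  DM N η μ (siteL r) + DE N η r

end

/-- `M` is a generalized permutation matrix: its column `q` vanishes away from the row `σ q`,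
and its entries have modulus at most `c`. -/
structure IsMonomial {n : Type*} (M : Matrix n n ℂ) (σ : Equiv.Perm n) (c : ℝ) : Prop where
  support : ∀ p q, p ≠ σ q → M p q = 0
  bound : ∀ p q, ‖M p q‖ ≤ c

namespace IsMonomial

variable {n : Type*} {M M' : Matrix n n ℂ} {σ τ : Equiv.Perm n} {c d : ℝ}

theorem add (h : IsMonomial M σ c) (h' : IsMonomial M' σ d) : IsMonomial (M + M') σ (c + d) where
  support p q hpq := by simp [h.support p q hpq, h'.support p q hpq]
  bound p q := (norm_add_le _ _).trans (add_le_add (h.bound p q) (h'.bound p q))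

theorem sub (h : IsMonomial M σ c) (h' : IsMonomial M' σ d) : IsMonomial (M - M') σ (c + d) where
  support p q hpq := by simp [h.support p q hpq, h'.support p q hpq]
  bound p q := (norm_sub_le _ _).trans (add_le_add (h.bound p q) (h'.bound p q))

theorem smul (h : IsMonomial M σ c) (a : ℂ) : IsMonomial (a • M) σ (‖a‖ * c) where
  support p q hpq := by simp [h.support p q hpq]
  bound p q := by
    rw [Matrix.smul_apply, smul_eq_mul, norm_mul]
    exact mul_le_mul_of_nonneg_left (h.bound p q) (norm_nonneg a)

theorem conjTranspose (h : IsMonomial M σ c) : IsMonomial Mᴴ σ⁻¹ c where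
  support p q hpq := by
    have : M q p = 0 := h.support q p fun hq => hpq (by simp [hq])
    simp [this]
  bound p q := by simpa using h.bound q p

theorem mul [Fintype n] (h : IsMonomial M σ c) (h' : IsMonomial M' τ d) :
    IsMonomial (M * M') (σ * τ) (c * d) := by
  have key (p q : n) : (M * M') p q = M p (τ q) * M' (τ q) q := by
    rw [Matrix.mul_apply]
    exact Fintype.sum_eq_single _ fun k hk => by rw [h'.support k q hk, mul_zero]
  refine ⟨fun p q hpq => ?_, fun p q => ?_⟩
  · rw [key, h.support p (τ q) hpq, zero_mul]
  · rw [key, norm_mul]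
    exact mul_le_mul (h.bound _ _) (h'.bound _ _) (norm_nonneg _)
      ((norm_nonneg _).trans (h.bound p (τ q)))

theorem specNorm_le [Fintype n] [DecidableEq n] (h : IsMonomial M σ c) (hc : 0 ≤ c) :
    specNorm M ≤ c := by
  refine ContinuousLinearMap.opNorm_le_bound _ hc fun v => ?_
  have key (q : n) : (Matrix.toEuclideanCLM (𝕜 := ℂ) M v) (σ q) = M (σ q) q * v q := by
    rw [Matrix.ofLp_toEuclideanCLM, Matrix.mulVec, dotProduct]
    exact Fintype.sum_eq_single _ fun k hk => by
      rw [h.support (σ q) k fun e => hk (σ.injective e).symm, zero_mul]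
  refine le_of_sq_le_sq ?_ (by positivity)
  rw [mul_pow, EuclideanSpace.norm_sq_eq, EuclideanSpace.norm_sq_eq, ← Equiv.sum_comp σ,
    Finset.mul_sum]
  refine Finset.sum_le_sum fun q _ => ?_
  rw [key, norm_mul, mul_pow]
  gcongr
  exact h.bound _ _

/-- The commutator of a diagonal matrix with a monomial one. -/
theorem diagonal_commutator [Fintype n] [DecidableEq n] (h : IsMonomial M σ c) {f : n → ℂ}
    (hd : 0 ≤ d) (hf : ∀ q, ‖f (σ q) - f q‖ ≤ d) :
    IsMonomial (diagonal f * M - M * diagonal f) σ (d * c) := by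
  have key (p q : n) : (diagonal f * M - M * diagonal f) p q = (f p - f q) * M p q := by
    rw [Matrix.sub_apply, Matrix.diagonal_mul, Matrix.mul_diagonal]
    ring
  refine ⟨fun p q hpq => by rw [key, h.support p q hpq, mul_zero], fun p q => ?_⟩
  rw [key, norm_mul]
  by_cases hpq : p = σ q
  · subst hpq
    exact mul_le_mul (hf q) (h.bound _ _) (norm_nonneg _) hd
  · rw [h.support p q hpq, norm_zero, mul_zero]
    exact mul_nonneg hd ((norm_nonneg _).trans (h.bound p q))

end IsMonomial

/-- The permutation of a product acting by `τ` on the factor `r`. -/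
def factorPerm {ι α : Type*} [DecidableEq ι] (r : ι) (τ : Equiv.Perm α) : Equiv.Perm (ι → α) :=
  Equiv.piCongrRight fun s => if s = r then τ else 1

theorem factorPerm_self {ι α : Type*} [DecidableEq ι] (r : ι) (τ : Equiv.Perm α) (f : ι → α) :
    factorPerm r τ f r = τ (f r) := by
  simp [factorPerm]

theorem factorPerm_of_ne {ι α : Type*} [DecidableEq ι] {r s : ι} (hs : s ≠ r) (τ : Equiv.Perm α)
    (f : ι → α) : factorPerm r τ f s = f s := by
  simp [factorPerm, hs]

theorem eq_factorPerm {ι α : Type*} [DecidableEq ι] {r : ι} {τ : Equiv.Perm α} {f g : ι → α}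
    (hne : ∀ s, s ≠ r → f s = g s) (hr : f r = τ (g r)) : f = factorPerm r τ g := by
  funext s
  by_cases hs : s = r
  · subst hs
    rw [hr, factorPerm_self]
  · rw [hne s hs, factorPerm_of_ne hs]

section Lattice

variable {N η : ℕ}

theorem IsMonomial.siteOp {M : Matrix (Fin 2) (Fin 2) ℂ} {τ : Equiv.Perm (Fin 2)} {c : ℝ}
    (h : IsMonomial M τ c) (r : Fin N) :
    IsMonomial (siteOp N η r M) (Equiv.prodCongr (factorPerm r τ) 1) c := by
  refine ⟨fun p q hpq => ?_, fun p q => ?_⟩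
  · rw [_root_.siteOp, Matrix.of_apply, ite_eq_right_iff]
    rintro ⟨h2, h1⟩
    exact h.support _ _ fun hr => hpq (Prod.ext (eq_factorPerm h1 hr) h2)
  · rw [_root_.siteOp, Matrix.of_apply]
    split_ifs
    · exact h.bound _ _
    · simpa using (norm_nonneg _).trans (h.bound (p.1 r) (q.1 r))

theorem IsMonomial.linkOp {M : Matrix (Fin (2 ^ η)) (Fin (2 ^ η)) ℂ}
    {τ : Equiv.Perm (Fin (2 ^ η))} {c : ℝ} (h : IsMonomial M τ c) (r : Fin (N - 1)) :
    IsMonomial (linkOp N η r M) (Equiv.prodCongr 1 (factorPerm r τ)) c := by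
  refine ⟨fun p q hpq => ?_, fun p q => ?_⟩
  · rw [_root_.linkOp, Matrix.of_apply, ite_eq_right_iff]
    rintro ⟨h1, h2⟩
    exact h.support _ _ fun hr => hpq (Prod.ext h1 (eq_factorPerm h2 hr))
  · rw [_root_.linkOp, Matrix.of_apply]
    split_ifs
    · exact h.bound _ _
    · simpa using (norm_nonneg _).trans (h.bound (p.2 r) (q.2 r))

theorem isMonomial_PX : IsMonomial PX (Equiv.swap 0 1) 1 := by
  constructor <;> intro p q <;> fin_cases p <;> fin_cases q <;> simp [PX]

theorem isMonomial_PY : IsMonomial PY (Equiv.swap 0 1) 1 := by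
  constructor <;> intro p q <;> fin_cases p <;> fin_cases q <;> simp [PY]

/-- The permutation of configurations flipping both qubits adjacent to the link `r`. -/
def flipPerm (N η : ℕ) (r : Fin (N - 1)) : Equiv.Perm (Config N η) :=
  Equiv.prodCongr (factorPerm (siteL r) (Equiv.swap 0 1)) 1 *
    Equiv.prodCongr (factorPerm (siteR r) (Equiv.swap 0 1)) 1

theorem flipPerm_snd (r : Fin (N - 1)) (q : Config N η) : (flipPerm N η r q).2 = q.2 := rfl

theorem isMonomial_Gop (r : Fin (N - 1)) : IsMonomial (Gop N η r) (flipPerm N η r) 2 := by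
  have h := ((isMonomial_PX.siteOp (η := η) (siteL r)).mul (isMonomial_PX.siteOp (siteR r))).add
    ((isMonomial_PY.siteOp (siteL r)).mul (isMonomial_PY.siteOp (siteR r)))
  norm_num at h
  exact h

theorem isMonomial_Gtilde (r : Fin (N - 1)) : IsMonomial (Gtilde N η r) (flipPerm N η r) 2 := by
  have h := ((isMonomial_PX.siteOp (η := η) (siteL r)).mul (isMonomial_PY.siteOp (siteR r))).sub
    ((isMonomial_PY.siteOp (siteL r)).mul (isMonomial_PX.siteOp (siteR r)))
  norm_num at h
  exact h

/-- `j ↦ j XOR 1` as a permutation. -/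
def xorPerm (hη : 1 ≤ η) : Equiv.Perm (Fin (2 ^ η)) :=
  Function.Involutive.toPerm
    (fun k => ⟨k ^^^ 1, Nat.xor_lt_two_pow k.2 (Nat.one_lt_two_pow (by omega))⟩)
    fun k => by simp

theorem xorPerm_val (hη : 1 ≤ η) (k : Fin (2 ^ η)) : (xorPerm hη k : ℕ) = (k : ℕ) ^^^ 1 := rfl

/-- `j ↦ j + 1 mod 2^η` as a permutation. -/
def shiftPerm (η : ℕ) : Equiv.Perm (Fin (2 ^ η)) := Equiv.addRight 1

theorem shiftPerm_val (hη : 1 ≤ η) (k : Fin (2 ^ η)) :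
    (shiftPerm η k : ℕ) = ((k : ℕ) + 1) % 2 ^ η := by
  have : 1 % 2 ^ η = 1 := Nat.mod_eq_of_lt (Nat.one_lt_two_pow (by omega))
  simp [shiftPerm, Fin.val_add, this]

theorem isMonomial_Aop (hη : 1 ≤ η) : IsMonomial (Aop η) (xorPerm hη) 1 := by
  refine ⟨fun p q hpq => if_neg fun e => hpq (Fin.ext e), fun p q => ?_⟩
  rw [Aop, Matrix.of_apply]
  split_ifs <;> simp

theorem isMonomial_Bop (hη : 1 ≤ η) : IsMonomial (Bop η) (xorPerm hη) 1 := by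
  refine ⟨fun p q hpq => if_neg fun e => hpq (Fin.ext e), fun p q => ?_⟩
  rw [Bop, Matrix.of_apply]
  split_ifs <;> simp

theorem isMonomial_Uop (hη : 1 ≤ η) : IsMonomial (Uop η) (shiftPerm η) 1 := by
  refine ⟨fun p q hpq => if_neg fun e => hpq (Fin.ext (e.trans (shiftPerm_val hη q).symm)),
    fun p q => ?_⟩
  rw [Uop, Matrix.of_apply]
  split_ifs <;> simp

theorem IsMonomial.conj_Uop (hη : 1 ≤ η) {M : Matrix (Fin (2 ^ η)) (Fin (2 ^ η)) ℂ}
    {τ : Equiv.Perm (Fin (2 ^ η))} {c : ℝ} (h : IsMonomial M τ c) :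
    IsMonomial ((Uop η)ᴴ * M * Uop η) ((shiftPerm η)⁻¹ * τ * shiftPerm η) c := by
  simpa using ((isMonomial_Uop hη).conjTranspose.mul h).mul (isMonomial_Uop hη)

theorem DE_eq_diagonal (r : Fin (N - 1)) :
    DE N η r = diagonal fun p : Config N η =>
      (((p.2 r : ℕ) : ℂ) - ((2 ^ (η - 1) : ℕ) : ℂ)) ^ 2 := by
  have h : linkOp N η r (Eop η) = diagonal fun p : Config N η =>
      ((p.2 r : ℕ) : ℂ) - ((2 ^ (η - 1) : ℕ) : ℂ) := by
    ext p q
    by_cases hpq : p = q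
    · subst hpq
      simp [linkOp, Eop]
    · rw [Matrix.diagonal_apply_ne _ hpq, linkOp, Matrix.of_apply, ite_eq_right_iff]
      rintro ⟨h1, h2⟩
      refine Matrix.diagonal_apply_ne _ fun hr => hpq (Prod.ext h1 (funext fun s => ?_))
      by_cases hs : s = r
      · rw [hs, hr]
      · exact h2 s hs
  rw [DE, h, Matrix.diagonal_pow]
  rfl

theorem two_pow_eq_two_mul_half (hη : 1 ≤ η) : 2 ^ η = 2 * 2 ^ (η - 1) := by
  rw [← pow_succ', Nat.sub_add_cancel hη]

/-- Cyclically adjacent levels of the truncated electric field. -/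
def CyclicAdj (L j k : ℕ) : Prop :=
  j = k + 1 ∨ k = j + 1 ∨ (j = 0 ∧ k + 1 = L) ∨ (k = 0 ∧ j + 1 = L)

theorem CyclicAdj.norm_sq_sub_sq_le {L j k : ℕ} (hj : j < 2 * L) (hk : k < 2 * L)
    (h : CyclicAdj (2 * L) j k) :
    ‖((j : ℂ) - (L : ℂ)) ^ 2 - ((k : ℂ) - (L : ℂ)) ^ 2‖ ≤ 2 * (L : ℝ) + 1 := by
  have e : ((j : ℂ) - (L : ℂ)) ^ 2 - ((k : ℂ) - (L : ℂ)) ^ 2 =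
      (((j : ℝ) - L) ^ 2 - ((k : ℝ) - L) ^ 2 : ℝ) := by push_cast; rfl
  have hj' : (j : ℝ) + 1 ≤ 2 * L := by exact_mod_cast hj
  have hk' : (k : ℝ) + 1 ≤ 2 * L := by exact_mod_cast hk
  have hj0 : (0 : ℝ) ≤ j := j.cast_nonneg
  have hk0 : (0 : ℝ) ≤ k := k.cast_nonneg
  rw [e, Complex.norm_real, Real.norm_eq_abs, abs_le]
  rcases h with h | h | ⟨h, h'⟩ | ⟨h, h'⟩
  · have : (j : ℝ) = k + 1 := by exact_mod_cast h
    constructor <;> nlinarith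
  · have : (k : ℝ) = j + 1 := by exact_mod_cast h
    constructor <;> nlinarith
  · have h1 : (j : ℝ) = 0 := by exact_mod_cast h
    have h2 : (k : ℝ) = 2 * L - 1 := by rw [eq_sub_iff_add_eq]; exact_mod_cast h'
    rw [h1, h2]
    constructor <;> nlinarith
  · have h1 : (k : ℝ) = 0 := by exact_mod_cast h
    have h2 : (j : ℝ) = 2 * L - 1 := by rw [eq_sub_iff_add_eq]; exact_mod_cast h'
    rw [h1, h2]
    constructor <;> nlinarith

theorem xor_one_eq_or (k : ℕ) : k ^^^ 1 = k + 1 ∨ k = (k ^^^ 1) + 1 := by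
  rcases Nat.even_or_odd k with h | h
  · exact Or.inl (Nat.xor_one_of_even h)
  · exact Or.inr (by rw [Nat.xor_one_of_odd h]; have := h.pos; omega)

theorem cyclicAdj_xorPerm (hη : 1 ≤ η) (k : Fin (2 ^ η)) :
    CyclicAdj (2 ^ η) (xorPerm hη k) k := by
  rw [xorPerm_val]
  rcases xor_one_eq_or k with h | h
  · exact Or.inl h
  · exact Or.inr (Or.inl h)

theorem CyclicAdj.of_shift {L j k : ℕ} (hj : j < L) (hk : k < L)
    (h : (j + 1) % L = (k + 1) % L + 1 ∨ (k + 1) % L = (j + 1) % L + 1) : CyclicAdj L j k := by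
  have mod_cases (i : ℕ) (hi : i < L) :
      (i + 1 < L ∧ (i + 1) % L = i + 1) ∨ (i + 1 = L ∧ (i + 1) % L = 0) := by
    rcases Nat.lt_or_ge (i + 1) L with hlt | hge
    · exact Or.inl ⟨hlt, Nat.mod_eq_of_lt hlt⟩
    · have : i + 1 = L := by omega
      exact Or.inr ⟨this, by rw [this, Nat.mod_self]⟩
  unfold CyclicAdj
  rcases mod_cases j hj with ⟨_, h1⟩ | ⟨_, h1⟩ <;> rcases mod_cases k hk with ⟨_, h2⟩ | ⟨_, h2⟩ <;>
    rw [h1, h2] at h <;> omega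

theorem cyclicAdj_conj_shiftPerm (hη : 1 ≤ η) (k : Fin (2 ^ η)) :
    CyclicAdj (2 ^ η) (((shiftPerm η)⁻¹ * xorPerm hη * shiftPerm η) k) k := by
  set j := ((shiftPerm η)⁻¹ * xorPerm hη * shiftPerm η) k with hj
  have h : shiftPerm η j = xorPerm hη (shiftPerm η k) := by simp [hj, Equiv.Perm.mul_apply]
  have h' := congrArg Fin.val h
  rw [xorPerm_val, shiftPerm_val hη, shiftPerm_val hη] at h'
  refine CyclicAdj.of_shift j.2 k.2 ?_
  rw [h']
  exact xor_one_eq_or _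

theorem specNorm_commutator_DE_le (hη : 1 ≤ η) {x : ℝ} (hx : 0 < x) (r : Fin (N - 1))
    {M : Matrix (Fin (2 ^ η)) (Fin (2 ^ η)) ℂ} {τ : Equiv.Perm (Fin (2 ^ η))} {G : LatOp N η}
    (hM : IsMonomial M τ 1) (hτ : ∀ k, CyclicAdj (2 ^ η) (τ k) k)
    (hG : IsMonomial G (flipPerm N η r) 2) :
    specNorm (DE N η r * (((x : ℂ) / 4) • (linkOp N η r M * G)) -
      (((x : ℂ) / 4) • (linkOp N η r M * G)) * DE N η r) ≤
      x * ((2 ^ (η - 1) : ℕ) + 1 / 2) := by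
  have hT := ((hM.linkOp r).mul hG).smul ((x : ℂ) / 4)
  rw [DE_eq_diagonal]
  have hnorm : ‖(x : ℂ) / 4‖ = x / 4 := by simp [abs_of_pos hx]
  have hpow := two_pow_eq_two_mul_half hη
  refine ((hT.diagonal_commutator (d := 2 * ((2 ^ (η - 1) : ℕ) : ℝ) + 1) (by positivity)
    fun q => ?_).specNorm_le (by positivity)).trans (le_of_eq ?_)
  · have hval : ((Equiv.prodCongr 1 (factorPerm r τ) * flipPerm N η r :
        Equiv.Perm (Config N η)) q).2 r = τ (q.2 r) :=
      (factorPerm_self r τ (flipPerm N η r q).2).trans (by rw [flipPerm_snd])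
    rw [hval]
    exact CyclicAdj.norm_sq_sub_sq_le ((τ (q.2 r)).2.trans_eq hpow) ((q.2 r).2.trans_eq hpow)
      (hpow ▸ hτ (q.2 r))
  · rw [hnorm]
    ring

end Lattice

/-- For every link `r` (the paper's `1 ≤ r ≤ N-1`) and every `j ∈ {1,2,3,4}`,
the spectral norm of the commutator of the squared electric field with the hopping term
satisfies `‖[E_r², T_r^(j)]‖ ≤ x (Λ + 1/2)`, where `Λ = 2^(η-1)`. -/
theorem commutator_Esq_hopping_bound
    (N η : ℕ) (hN : 2 ≤ N) (hNeven : Even N) (hη : 1 ≤ η) (x μ : ℝ) (hx : 0 < x) (hμ : 0 ≤ μ)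
    (r : Fin (N - 1)) (j : Fin 4) :
    specNorm (DE N η r * Thop N η x r j - Thop N η x r j * DE N η r) ≤
      x * ((2 ^ (η - 1) : ℕ) + 1 / 2) := by
  match j with
  | 0 =>
    exact specNorm_commutator_DE_le hη hx r (isMonomial_Aop hη) (cyclicAdj_xorPerm hη)
      (isMonomial_Gop r)
  | 1 =>
    exact specNorm_commutator_DE_le hη hx r ((isMonomial_Aop hη).conj_Uop hη)
      (cyclicAdj_conj_shiftPerm hη) (isMonomial_Gop r)
  | 2 =>
    exact specNorm_commutator_DE_le hη hx r ((isMonomial_Bop hη).conj_Uop hη)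
      (cyclicAdj_conj_shiftPerm hη) (isMonomial_Gtilde r)
  | 3 =>
    exact specNorm_commutator_DE_le hη hx r (isMonomial_Bop hη) (cyclicAdj_xorPerm hη)
      (isMonomial_Gtilde r)
end

section
/- For every 1 ≤ r ≤ N−1 and every i ∈ {1,2,3,4}, ‖[[D_r, T_r^(i)], D_r]‖ ≤ x·(2Λ² + (2+2μ)Λ + μ²/2 + μ + 1/2). -/
open Matrix Complex

/-- A matrix supported on the graph of an involution has spectral norm at most the largest modulus
of its entries. -/
lemma specNorm_le_of_involutive {n : Type*} [Fintype n] [DecidableEq n] (M : Matrix n n ℂ)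
    (σ : n → n) (hσ : Function.Involutive σ) {C : ℝ} (hC : 0 ≤ C)
    (hsupp : ∀ p q, M p q ≠ 0 → p = σ q) (hM : ∀ p q, ‖M p q‖ ≤ C) : specNorm M ≤ C := by
  refine ContinuousLinearMap.opNorm_le_bound _ hC fun v => ?_
  have hmul : ∀ p, (Matrix.toEuclideanCLM (𝕜 := ℂ) M v) p = M p (σ p) * v (σ p) := by
    intro p
    change ∑ q, M p q * v q = _
    refine Finset.sum_eq_single (σ p) (fun q _ hq => ?_) (by simp)
    have h0 : M p q = 0 := by
      by_contra h
      exact hq (by rw [hsupp p q h, hσ q])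
    simp [h0]
  refine le_of_sq_le_sq ?_ (by positivity)
  rw [mul_pow, EuclideanSpace.norm_sq_eq, EuclideanSpace.norm_sq_eq, Finset.mul_sum,
    ← Equiv.sum_comp hσ.toPerm (fun q => C ^ 2 * ‖v q‖ ^ 2)]
  refine Finset.sum_le_sum fun p _ => ?_
  rw [hmul, norm_mul, mul_pow]
  have := hM p (σ p)
  change _ ≤ C ^ 2 * ‖v (σ p)‖ ^ 2
  gcongr

lemma siteOp_diagonal (N η : ℕ) (r : Fin N) (v : Fin 2 → ℂ) :
    siteOp N η r (diagonal v) = diagonal fun p => v (p.1 r) := by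
  ext p q
  by_cases h : p = q
  · subst h
    simp [siteOp]
  · rw [diagonal_apply_ne _ h]
    simp only [siteOp, of_apply]
    split_ifs with hpq
    · refine diagonal_apply_ne _ fun hr => h (Prod.ext (funext fun s => ?_) hpq.1)
      by_cases hs : s = r
      · rw [hs, hr]
      · exact hpq.2 s hs
    · rfl

lemma linkOp_diagonal (N η : ℕ) (r : Fin (N - 1)) (v : Fin (2 ^ η) → ℂ) :
    linkOp N η r (diagonal v) = diagonal fun p => v (p.2 r) := by
  ext p q
  by_cases h : p = q
  · subst h
    simp [linkOp]
  · rw [diagonal_apply_ne _ h]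
    simp only [linkOp, of_apply]
    split_ifs with hpq
    · refine diagonal_apply_ne _ fun hr => h (Prod.ext hpq.1 (funext fun s => ?_))
      by_cases hs : s = r
      · rw [hs, hr]
      · exact hpq.2 s hs
    · rfl

/-- The diagonal entries of `Dlink`. -/
noncomputable def DlinkEntry (N η : ℕ) (μ : ℝ) (r : Fin (N - 1)) (p : Config N η) : ℝ :=
  (-μ / 2) * (-1) ^ ((r : ℕ) + 1) * ![1, -1] (p.1 (siteL r))
    + (((p.2 r : ℕ) : ℝ) - ((2 ^ (η - 1) : ℕ) : ℝ)) ^ 2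

lemma Dlink_eq_diagonal (N η : ℕ) (μ : ℝ) (r : Fin (N - 1)) :
    Dlink N η μ r = diagonal fun p => (DlinkEntry N η μ r p : ℂ) := by
  have hZ : PZ = diagonal ![1, -1] := by
    ext i j
    fin_cases i <;> fin_cases j <;> simp [PZ]
  rw [Dlink, DM, DE, hZ, Eop, siteOp_diagonal, linkOp_diagonal, diagonal_pow, ← diagonal_smul,
    diagonal_add]
  congr 1
  funext p
  have hz : ∀ k : Fin 2, (![1, -1] k : ℂ) = ((![1, -1] k : ℝ) : ℂ) := by
    intro k
    fin_cases k <;> simp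
  simp only [DlinkEntry, siteL, Pi.smul_apply, Pi.pow_apply, smul_eq_mul]
  rw [hz]
  push_cast
  ring

lemma siteOp_mul_siteOp_apply (N η : ℕ) {a b : Fin N} (hab : a ≠ b)
    (M M' : Matrix (Fin 2) (Fin 2) ℂ) (p q : Config N η) :
    (siteOp N η a M * siteOp N η b M') p q =
      if p.2 = q.2 ∧ ∀ s, s ≠ a → s ≠ b → p.1 s = q.1 s then
        M (p.1 a) (q.1 a) * M' (p.1 b) (q.1 b) else 0 := by
  rw [mul_apply, Finset.sum_eq_single ((Function.update p.1 a (q.1 a), p.2) : Config N η)]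
  · have h1 : siteOp N η a M p (Function.update p.1 a (q.1 a), p.2) = M (p.1 a) (q.1 a) := by
      simp +contextual [siteOp, Function.update_of_ne]
    have h2 : siteOp N η b M' (Function.update p.1 a (q.1 a), p.2) q =
        if p.2 = q.2 ∧ ∀ s, s ≠ a → s ≠ b → p.1 s = q.1 s then M' (p.1 b) (q.1 b) else 0 := by
      simp only [siteOp, of_apply, Function.update_of_ne hab.symm]
      refine if_congr (and_congr_right fun _ => forall_congr' fun s => ?_) rfl rfl
      by_cases hs : s = a
      · subst hs; simp
      · simp [hs, Function.update_of_ne]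
    rw [h1, h2, mul_ite, mul_zero]
  · intro c _ hc
    by_contra h
    obtain ⟨h1, h2⟩ := mul_ne_zero_iff.mp h
    simp only [siteOp, of_apply, ne_eq, ite_eq_right_iff, Classical.not_imp] at h1 h2
    refine hc (Prod.ext (funext fun s => ?_) h1.1.1.symm)
    by_cases hs : s = a
    · subst hs
      simpa using h2.1.2 s hab
    · simpa [Function.update_of_ne hs] using (h1.1.2 s hs).symm
  · simp

lemma linkOp_mul_apply (N η : ℕ) (r : Fin (N - 1)) (L : Matrix (Fin (2 ^ η)) (Fin (2 ^ η)) ℂ)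
    (G : LatOp N η) (hG : ∀ p q, G p q ≠ 0 → p.2 = q.2) (p q : Config N η) :
    (linkOp N η r L * G) p q = linkOp N η r L p (p.1, q.2) * G (p.1, q.2) q := by
  rw [mul_apply]
  refine Finset.sum_eq_single _ (fun c _ hc => ?_) (by simp)
  by_contra h
  obtain ⟨h1, h2⟩ := mul_ne_zero_iff.mp h
  simp only [linkOp, of_apply, ne_eq, ite_eq_right_iff, Classical.not_imp] at h1
  exact hc (Prod.ext h1.1.1.symm (hG c q h2))

/-- Flip the two qubits at the ends of the link `r`. -/
def flipEnds {N : ℕ} (r : Fin (N - 1)) (f : Fin N → Fin 2) : Fin N → Fin 2 :=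
  fun s => if s = siteL r ∨ s = siteR r then f s + 1 else f s

lemma flipEnds_involutive {N : ℕ} (r : Fin (N - 1)) : Function.Involutive (flipEnds r) := by
  have h2 : ∀ k : Fin 2, k + 1 + 1 = k := by decide
  intro f
  funext s
  by_cases hs : s = siteL r ∨ s = siteR r <;> simp only [flipEnds, hs, if_true, if_false, h2]

/-- The operator acts as a hop on the two ends of the link `r`, with amplitude at most two. -/
def IsEndHop (N η : ℕ) (r : Fin (N - 1)) (G : LatOp N η) : Prop :=
  ∀ p q, ‖G p q‖ ≤ 2 ∧ (G p q ≠ 0 → p.2 = q.2 ∧ p.1 = flipEnds r q.1)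

lemma siteL_ne_siteR {N : ℕ} (r : Fin (N - 1)) : siteL r ≠ siteR r := by
  simp [siteL, siteR]

lemma isEndHop_of_apply (N η : ℕ) (r : Fin (N - 1)) (G : LatOp N η)
    (g : Fin 2 → Fin 2 → Fin 2 → Fin 2 → ℂ)
    (hg : ∀ a b c d, ‖g a b c d‖ ≤ 2 ∧ (g a b c d ≠ 0 → a = b + 1 ∧ c = d + 1))
    (hG : ∀ p q, G p q = if p.2 = q.2 ∧ ∀ s, s ≠ siteL r → s ≠ siteR r → p.1 s = q.1 s then
      g (p.1 (siteL r)) (q.1 (siteL r)) (p.1 (siteR r)) (q.1 (siteR r)) else 0) :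
    IsEndHop N η r G := by
  intro p q
  rw [hG]
  split_ifs with h
  · refine ⟨(hg _ _ _ _).1, fun hne => ⟨h.1, funext fun s => ?_⟩⟩
    obtain ⟨hl, hr⟩ := (hg _ _ _ _).2 hne
    unfold flipEnds
    split_ifs with hs
    · rcases hs with rfl | rfl
      · exact hl
      · exact hr
    · rw [not_or] at hs
      exact h.2 s hs.1 hs.2
  · simp

lemma isEndHop_Gop (N η : ℕ) (r : Fin (N - 1)) : IsEndHop N η r (Gop N η r) := by
  refine isEndHop_of_apply N η r _ (fun a b c d => PX a b * PX c d + PY a b * PY c d) ?_ ?_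
  · intro a b c d
    fin_cases a <;> fin_cases b <;> fin_cases c <;> fin_cases d <;>
      simp [PX, PY] <;> norm_num
  · intro p q
    rw [Gop, Matrix.add_apply, siteOp_mul_siteOp_apply N η (siteL_ne_siteR r),
      siteOp_mul_siteOp_apply N η (siteL_ne_siteR r)]
    split_ifs <;> simp

lemma isEndHop_Gtilde (N η : ℕ) (r : Fin (N - 1)) : IsEndHop N η r (Gtilde N η r) := by
  refine isEndHop_of_apply N η r _ (fun a b c d => PX a b * PY c d - PY a b * PX c d) ?_ ?_
  · have h2 : ‖I + I‖ = 2 := by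
      rw [← two_mul]; simp
    have h2' : ‖-I - I‖ = 2 := by
      rw [← neg_add', norm_neg, h2]
    intro a b c d
    fin_cases a <;> fin_cases b <;> fin_cases c <;> fin_cases d <;>
      simp [PX, PY, h2, h2']
  · intro p q
    rw [Gtilde, Matrix.sub_apply, siteOp_mul_siteOp_apply N η (siteL_ne_siteR r),
      siteOp_mul_siteOp_apply N η (siteL_ne_siteR r)]
    split_ifs <;> simp

/-- Two naturals below `n` are cyclically adjacent. -/
def CycAdj (n j k : ℕ) : Prop :=
  j + 1 = k ∨ k + 1 = j ∨ (j = 0 ∧ k + 1 = n) ∨ (k = 0 ∧ j + 1 = n)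

/-- The link operator is supported on an involution moving each level to a cyclically adjacent one,
with entries of modulus at most one. -/
def IsLinkHop (η : ℕ) (L : Matrix (Fin (2 ^ η)) (Fin (2 ^ η)) ℂ) : Prop :=
  ∃ τ : Fin (2 ^ η) → Fin (2 ^ η), Function.Involutive τ ∧
    ∀ j k, ‖L j k‖ ≤ 1 ∧ (L j k ≠ 0 → j = τ k ∧ CycAdj (2 ^ η) j k)

lemma xor_one_adjacent {a b : ℕ} (h : a = b ^^^ 1) : a + 1 = b ∨ b + 1 = a := by
  subst h
  rcases Nat.even_or_odd b with hb | hb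
  · rw [Nat.even_iff] at hb
    have := Nat.xor_one_of_even (Nat.even_iff.mpr hb)
    omega
  · have := Nat.xor_one_of_odd hb
    have := hb.pos
    omega

/-- Flipping the last binary digit. -/
def xorOne {η : ℕ} (hη : 1 ≤ η) (k : Fin (2 ^ η)) : Fin (2 ^ η) :=
  ⟨(k : ℕ) ^^^ 1, Nat.xor_lt_two_pow k.2 (Nat.one_lt_two_pow (by omega))⟩

lemma xorOne_involutive {η : ℕ} (hη : 1 ≤ η) : Function.Involutive (xorOne hη) := by
  intro k
  ext
  simp [xorOne]

lemma isLinkHop_of_xor {η : ℕ} (hη : 1 ≤ η) (L : Matrix (Fin (2 ^ η)) (Fin (2 ^ η)) ℂ)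
    (hL : ∀ j k, ‖L j k‖ ≤ 1 ∧ (L j k ≠ 0 → (j : ℕ) = (k : ℕ) ^^^ 1)) : IsLinkHop η L := by
  refine ⟨xorOne hη, xorOne_involutive hη, fun j k => ⟨(hL j k).1, fun h => ?_⟩⟩
  have h' := (hL j k).2 h
  refine ⟨Fin.ext h', ?_⟩
  rcases xor_one_adjacent h' with h | h
  · exact .inl h
  · exact .inr (.inl h)

lemma Uop_conj_apply (η : ℕ) (L : Matrix (Fin (2 ^ η)) (Fin (2 ^ η)) ℂ) (j k : Fin (2 ^ η)) :
    ((Uop η)ᴴ * L * Uop η) j k = L (j + 1) (k + 1) := by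
  have hU : ∀ a b : Fin (2 ^ η), Uop η a b = if a = b + 1 then 1 else 0 := by
    intro a b
    simp only [Uop, of_apply, Fin.ext_iff, Fin.val_add, Fin.val_one', Nat.add_mod_mod]
  simp [mul_apply, hU, apply_ite]

lemma isLinkHop_Uop_conj_of_xor {η : ℕ} (hη : 1 ≤ η) (L : Matrix (Fin (2 ^ η)) (Fin (2 ^ η)) ℂ)
    (hL : ∀ j k, ‖L j k‖ ≤ 1 ∧ (L j k ≠ 0 → (j : ℕ) = (k : ℕ) ^^^ 1)) :
    IsLinkHop η ((Uop η)ᴴ * L * Uop η) := by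
  have hn : 2 ≤ 2 ^ η := by simpa using Nat.pow_le_pow_right (n := 2) (by norm_num) hη
  refine ⟨fun k => xorOne hη (k + 1) - 1, fun k => ?_, fun j k => ?_⟩
  · simp only [sub_add_cancel, xorOne_involutive hη (k + 1), add_sub_cancel_right]
  · rw [Uop_conj_apply]
    refine ⟨(hL _ _).1, fun h => ?_⟩
    have h' := (hL _ _).2 h
    refine ⟨eq_sub_of_add_eq (Fin.ext h'), ?_⟩
    have hval : ∀ a : Fin (2 ^ η), ((a + 1 : Fin (2 ^ η)) : ℕ) = ((a : ℕ) + 1) % 2 ^ η := by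
      intro a
      simp only [Fin.val_add, Fin.val_one', Nat.add_mod_mod]
    have hwrap : ∀ a : Fin (2 ^ η), (((a : ℕ) + 1) % 2 ^ η = (a : ℕ) + 1 ∧ (a : ℕ) + 1 < 2 ^ η) ∨
        (((a : ℕ) + 1) % 2 ^ η = 0 ∧ (a : ℕ) + 1 = 2 ^ η) := by
      intro a
      rcases Nat.lt_or_ge ((a : ℕ) + 1) (2 ^ η) with ha | ha
      · exact .inl ⟨Nat.mod_eq_of_lt ha, ha⟩
      · have : (a : ℕ) + 1 = 2 ^ η := le_antisymm a.2 ha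
        exact .inr ⟨by rw [this, Nat.mod_self], this⟩
    have hadj := xor_one_adjacent h'
    rw [hval, hval] at hadj
    unfold CycAdj
    rcases hwrap j with hj | hj <;> rcases hwrap k with hk | hk <;> omega

lemma Aop_xor (η : ℕ) (j k : Fin (2 ^ η)) :
    ‖Aop η j k‖ ≤ 1 ∧ (Aop η j k ≠ 0 → (j : ℕ) = (k : ℕ) ^^^ 1) := by
  simp only [Aop, of_apply]
  split_ifs with h <;> simp [h]

lemma Bop_xor (η : ℕ) (j k : Fin (2 ^ η)) :
    ‖Bop η j k‖ ≤ 1 ∧ (Bop η j k ≠ 0 → (j : ℕ) = (k : ℕ) ^^^ 1) := by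
  simp only [Bop, of_apply]
  split_ifs with h <;> simp [h]

lemma abs_sq_sub_sq_le_of_cycAdj {n j k : ℕ} (hj : j < n) (hk : k < n) (h : CycAdj n j k)
    {Λ : ℝ} (hΛ : (n : ℝ) = 2 * Λ) :
    |((j : ℝ) - Λ) ^ 2 - ((k : ℝ) - Λ) ^ 2| ≤ 2 * Λ + 1 := by
  have hj' : (j : ℝ) + 1 ≤ n := by exact_mod_cast hj
  have hk' : (k : ℝ) + 1 ≤ n := by exact_mod_cast hk
  have hj0 : (0 : ℝ) ≤ j := j.cast_nonneg
  have hk0 : (0 : ℝ) ≤ k := k.cast_nonneg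
  rw [abs_le]
  rcases h with h | h | ⟨h0, h⟩ | ⟨h0, h⟩
  · have : (k : ℝ) = j + 1 := by exact_mod_cast h.symm
    rw [this]
    constructor <;> linarith
  · have : (j : ℝ) = k + 1 := by exact_mod_cast h.symm
    rw [this]
    constructor <;> linarith
  · have : (k : ℝ) = 2 * Λ - 1 := by rw [← hΛ, ← h]; push_cast; ring
    rw [this, h0]
    push_cast
    constructor <;> linarith
  · have : (j : ℝ) = 2 * Λ - 1 := by rw [← hΛ, ← h]; push_cast; ring
    rw [this, h0]
    push_cast
    constructor <;> linarith

lemma abs_DlinkEntry_sub_le {N η : ℕ} (hη : 1 ≤ η) {μ : ℝ} (hμ : 0 ≤ μ) (r : Fin (N - 1))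
    {p q : Config N η} (h : CycAdj (2 ^ η) (p.2 r) (q.2 r)) :
    |DlinkEntry N η μ r p - DlinkEntry N η μ r q| ≤ 2 * ((2 ^ (η - 1) : ℕ) : ℝ) + 1 + μ := by
  have hΛ : ((2 ^ η : ℕ) : ℝ) = 2 * ((2 ^ (η - 1) : ℕ) : ℝ) := by
    obtain ⟨m, rfl⟩ := Nat.exists_eq_add_of_le' hη
    push_cast [pow_succ]
    ring
  have hE := abs_sq_sub_sq_le_of_cycAdj (p.2 r).2 (q.2 r).2 h hΛ
  have hz : ∀ a b : Fin 2, |(![1, -1] a : ℝ) - ![1, -1] b| ≤ 2 := by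
    intro a b
    fin_cases a <;> fin_cases b <;> norm_num
  have hM : |(-μ / 2) * (-1) ^ ((r : ℕ) + 1) *
      ((![1, -1] (p.1 (siteL r)) : ℝ) - ![1, -1] (q.1 (siteL r)))| ≤ μ := by
    rw [abs_mul, abs_mul, abs_pow, abs_neg, abs_one, one_pow, mul_one, abs_div, abs_neg,
      abs_of_nonneg hμ, abs_of_nonneg (by norm_num : (0 : ℝ) ≤ 2)]
    nlinarith [hz (p.1 (siteL r)) (q.1 (siteL r))]
  have hsplit : DlinkEntry N η μ r p - DlinkEntry N η μ r q =
      (-μ / 2) * (-1) ^ ((r : ℕ) + 1) *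
        ((![1, -1] (p.1 (siteL r)) : ℝ) - ![1, -1] (q.1 (siteL r))) +
      ((((p.2 r : ℕ) : ℝ) - ((2 ^ (η - 1) : ℕ) : ℝ)) ^ 2
        - (((q.2 r : ℕ) : ℝ) - ((2 ^ (η - 1) : ℕ) : ℝ)) ^ 2) := by
    unfold DlinkEntry
    ring
  rw [hsplit]
  exact (abs_add_le _ _).trans (by linarith)

lemma doubleCommutator_diagonal_apply {n : Type*} [Fintype n] [DecidableEq n] (d : n → ℂ)
    (T : Matrix n n ℂ) (p q : n) :
    ((diagonal d * T - T * diagonal d) * diagonal d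
      - diagonal d * (diagonal d * T - T * diagonal d)) p q = -((d p - d q) ^ 2 * T p q) := by
  simp only [Matrix.sub_apply, mul_diagonal, diagonal_mul]
  ring

lemma specNorm_doubleCommutator_hop_le {N η : ℕ} (hη : 1 ≤ η) {x μ : ℝ} (hx : 0 < x)
    (hμ : 0 ≤ μ) (r : Fin (N - 1)) {L : Matrix (Fin (2 ^ η)) (Fin (2 ^ η)) ℂ} {G T : LatOp N η}
    (hL : IsLinkHop η L) (hG : IsEndHop N η r G)
    (hT : T = ((x : ℂ) / 4) • (linkOp N η r L * G)) :
    specNorm ((Dlink N η μ r * T - T * Dlink N η μ r) * Dlink N η μ r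
        - Dlink N η μ r * (Dlink N η μ r * T - T * Dlink N η μ r)) ≤
      (2 * ((2 ^ (η - 1) : ℕ) : ℝ) + 1 + μ) ^ 2 * (x / 2) := by
  obtain ⟨τ, hτ, hL⟩ := hL
  have hTapply : ∀ p q, T p q =
      (x : ℂ) / 4 * (linkOp N η r L p (p.1, q.2) * G (p.1, q.2) q) := by
    intro p q
    rw [hT, Matrix.smul_apply, linkOp_mul_apply N η r L G (fun p q h => ((hG p q).2 h).1), smul_eq_mul]
  have hTnorm : ∀ p q, ‖T p q‖ ≤ x / 2 := by
    intro p q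
    have hl : ‖linkOp N η r L p (p.1, q.2)‖ ≤ 1 := by
      simp only [linkOp, of_apply]
      split_ifs
      · exact (hL _ _).1
      · simp
    have hx4 : ‖(x : ℂ) / 4‖ = x / 4 := by
      simp [abs_of_pos hx]
    rw [hTapply, norm_mul, norm_mul, hx4]
    have := mul_le_mul hl (hG (p.1, q.2) q).1 (norm_nonneg _) zero_le_one
    nlinarith
  have hTsupp : ∀ p q, T p q ≠ 0 → p.1 = flipEnds r q.1 ∧ (∀ s, s ≠ r → p.2 s = q.2 s) ∧
      p.2 r = τ (q.2 r) ∧ CycAdj (2 ^ η) (p.2 r) (q.2 r) := by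
    intro p q h
    rw [hTapply] at h
    obtain ⟨h1, h2⟩ := mul_ne_zero_iff.mp (right_ne_zero_of_mul h)
    simp only [linkOp, of_apply, ne_eq, ite_eq_right_iff, Classical.not_imp] at h1
    exact ⟨((hG _ _).2 h2).2, h1.1.2, (hL _ _).2 h1.2⟩
  rw [Dlink_eq_diagonal]
  refine specNorm_le_of_involutive _
    (fun q => (flipEnds r q.1, Function.update q.2 r (τ (q.2 r)))) ?_ (by positivity) ?_ ?_
  · intro q
    simp [flipEnds_involutive r q.1, hτ (q.2 r)]
  · intro p q h
    rw [doubleCommutator_diagonal_apply] at h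
    obtain ⟨h1, h2, h3, -⟩ := hTsupp p q (right_ne_zero_of_mul (neg_ne_zero.mp h))
    refine Prod.ext h1 (funext fun s => ?_)
    by_cases hs : s = r
    · subst hs
      simpa using h3
    · simpa [Function.update_of_ne hs] using h2 s hs
  · intro p q
    rw [doubleCommutator_diagonal_apply]
    by_cases h : T p q = 0
    · rw [h, mul_zero, neg_zero, norm_zero]
      positivity
    · have hD := abs_DlinkEntry_sub_le hη hμ r (hTsupp p q h).2.2.2
      rw [norm_neg, norm_mul, norm_pow, ← Complex.ofReal_sub, Complex.norm_real, Real.norm_eq_abs]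
      have := hTnorm p q
      gcongr

/-- For every link `r` (the paper's `1 ≤ r ≤ N-1`) and every `i ∈ {1,2,3,4}`,
`‖[[D_r, T_r^(i)], D_r]‖ ≤ x (2Λ² + (2 + 2μ)Λ + μ²/2 + μ + 1/2)`, where `Λ = 2^(η-1)`. -/
theorem double_commutator_D_T_D_bound
    (N η : ℕ) (hN : 2 ≤ N) (hNeven : Even N) (hη : 1 ≤ η) (x μ : ℝ) (hx : 0 < x) (hμ : 0 ≤ μ)
    (r : Fin (N - 1)) (i : Fin 4) :
    specNorm ((Dlink N η μ r * Thop N η x r i - Thop N η x r i * Dlink N η μ r) * Dlink N η μ r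
        - Dlink N η μ r * (Dlink N η μ r * Thop N η x r i - Thop N η x r i * Dlink N η μ r)) ≤
      x * (2 * ((2 ^ (η - 1) : ℕ) : ℝ) ^ 2 + (2 + 2 * μ) * ((2 ^ (η - 1) : ℕ) : ℝ)
        + μ ^ 2 / 2 + μ + 1 / 2) := by
  have key : specNorm ((Dlink N η μ r * Thop N η x r i - Thop N η x r i * Dlink N η μ r) *
      Dlink N η μ r - Dlink N η μ r * (Dlink N η μ r * Thop N η x r i
        - Thop N η x r i * Dlink N η μ r)) ≤
      (2 * ((2 ^ (η - 1) : ℕ) : ℝ) + 1 + μ) ^ 2 * (x / 2) := by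
    match i with
    | 0 =>
      exact specNorm_doubleCommutator_hop_le hη hx hμ r
        (isLinkHop_of_xor hη _ (Aop_xor η)) (isEndHop_Gop N η r) rfl
    | 1 =>
      exact specNorm_doubleCommutator_hop_le hη hx hμ r
        (isLinkHop_Uop_conj_of_xor hη _ (Aop_xor η)) (isEndHop_Gop N η r) rfl
    | 2 =>
      exact specNorm_doubleCommutator_hop_le hη hx hμ r
        (isLinkHop_Uop_conj_of_xor hη _ (Bop_xor η)) (isEndHop_Gtilde N η r) rfl
    | 3 =>
      exact specNorm_doubleCommutator_hop_le hη hx hμ r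
        (isLinkHop_of_xor hη _ (Bop_xor η)) (isEndHop_Gtilde N η r) rfl
  refine key.trans (le_of_eq ?_)
  ring
end

section
/- On the η-qubit register, (E + (1/2)·I)² = ((4^η − 1)/12)·I + Σ_{0 ≤ n < k ≤ η−1} 2^{n+k−1} · Z_n Z_k, where Z_n is the Pauli-Z matrix acting on the n-th qubit. -/
noncomputable section

/-- Pauli-`Z` acting on the `n`-th qubit of the `η`-qubit register, in the binary encoding
`|j⟩ = ⊗ₙ |jₙ⟩`, `j = ∑ₙ jₙ 2ⁿ`: it is diagonal with entry `(-1)^{jₙ}` at `|j⟩`. -/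
def Zbit (η : ℕ) (n : Fin η) : Matrix (Fin (2 ^ η)) (Fin (2 ^ η)) ℂ :=
  Matrix.diagonal fun j => (-1 : ℂ) ^ ((j : ℕ) / 2 ^ (n : ℕ) % 2)

end

open Finset in
/-- The square of a finite sum splits into the diagonal and twice the strictly upper part. -/
theorem sum_sq_eq_sum_sq_add_two_mul_sum_lt {ι R : Type*} [Fintype ι] [LinearOrder ι]
    [CommRing R] (a : ι → R) :
    (∑ i, a i) ^ 2 = ∑ i, a i ^ 2 + 2 * ∑ i, ∑ k, if i < k then a i * a k else 0 := by
  have split (i k : ι) : a i * a k = (if i = k then a i * a k else 0)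
      + (if i < k then a i * a k else 0) + (if k < i then a k * a i else 0) := by
    rcases lt_trichotomy i k with h | rfl | h
    · simp [h, h.ne, h.not_gt]
    · simp
    · simp [h, h.ne', h.not_gt, mul_comm]
  have swap : (∑ i, ∑ k, if k < i then a k * a i else 0)
      = ∑ i, ∑ k, if i < k then a i * a k else 0 := sum_comm
  rw [sq, sum_mul_sum, sum_congr rfl fun i _ => sum_congr rfl fun k _ => split i k]
  simp only [sum_add_distrib, swap, sum_ite_eq, mem_univ, if_true, sq]
  ring

/-- The weighted sum of the signs of the low bits of `j`. -/
theorem sum_range_two_pow_mul_neg_one_pow_bit {R : Type*} [CommRing R] (m j : ℕ) :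
    ∑ n ∈ Finset.range m, (2 : R) ^ n * (-1) ^ (j / 2 ^ n % 2)
      = 2 ^ m - 1 - 2 * ((j % 2 ^ m : ℕ) : R) := by
  induction m with
  | zero => simp [Nat.mod_one]
  | succ m ih =>
    rw [Finset.sum_range_succ, ih, Nat.mod_pow_succ]
    rcases Nat.mod_two_eq_zero_or_one (j / 2 ^ m) with h | h <;> simp [h] <;> ring

/-- The sum of the squared weights is a geometric sum. -/
theorem three_mul_sum_range_sq_two_pow_mul_neg_one_pow {R : Type*} [CommRing R] (m : ℕ)
    (e : ℕ → ℕ) :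
    3 * ∑ n ∈ Finset.range m, ((2 : R) ^ n * (-1) ^ e n) ^ 2 = 4 ^ m - 1 := by
  induction m with
  | zero => simp
  | succ m ih =>
    rw [Finset.sum_range_succ, mul_add, ih, mul_pow, ← pow_mul, ← pow_mul (-1 : R),
      mul_comm m 2, mul_comm (e m) 2, pow_mul, pow_mul (-1 : R)]
    norm_num
    ring

/-- The diagonal entries of the two sides of the Pauli decomposition agree. -/
theorem shifted_sq_eq_sum_sign_mul_sign (η : ℕ) (hη : 1 ≤ η) (j : Fin (2 ^ η)) :
    (((j : ℕ) : ℂ) - ((2 ^ (η - 1) : ℕ) : ℂ) + 1 / 2) ^ 2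
      = ((4 ^ η - 1 : ℕ) : ℂ) / 12 + ∑ n : Fin η, ∑ k : Fin η,
          if n < k then (2 : ℂ) ^ ((n : ℕ) + (k : ℕ) - 1)
            * ((-1) ^ ((j : ℕ) / 2 ^ (n : ℕ) % 2) * (-1) ^ ((j : ℕ) / 2 ^ (k : ℕ) % 2))
          else 0 := by
  have linear := sum_range_two_pow_mul_neg_one_pow_bit (R := ℂ) η j
  have geometric := three_mul_sum_range_sq_two_pow_mul_neg_one_pow (R := ℂ) η
    fun n => (j : ℕ) / 2 ^ n % 2
  rw [Nat.mod_eq_of_lt j.isLt, Finset.sum_range] at linear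
  rw [Finset.sum_range] at geometric
  have square := sum_sq_eq_sum_sq_add_two_mul_sum_lt
    fun n : Fin η => (2 : ℂ) ^ (n : ℕ) * (-1) ^ ((j : ℕ) / 2 ^ (n : ℕ) % 2)
  have offdiag : (∑ n : Fin η, ∑ k : Fin η, if n < k then
        ((2 : ℂ) ^ (n : ℕ) * (-1) ^ ((j : ℕ) / 2 ^ (n : ℕ) % 2))
          * ((2 : ℂ) ^ (k : ℕ) * (-1) ^ ((j : ℕ) / 2 ^ (k : ℕ) % 2)) else 0)
      = 2 * ∑ n : Fin η, ∑ k : Fin η,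
          if n < k then (2 : ℂ) ^ ((n : ℕ) + (k : ℕ) - 1)
            * ((-1) ^ ((j : ℕ) / 2 ^ (n : ℕ) % 2) * (-1) ^ ((j : ℕ) / 2 ^ (k : ℕ) % 2))
          else 0 := by
    simp only [Finset.mul_sum]
    refine Finset.sum_congr rfl fun n _ => Finset.sum_congr rfl fun k _ => ?_
    split_ifs with h
    · have weight : (2 : ℂ) ^ (n : ℕ) * 2 ^ (k : ℕ) = 2 * 2 ^ ((n : ℕ) + (k : ℕ) - 1) := by
        rw [← pow_add, ← pow_succ']
        congr 1
        have : (n : ℕ) < k := h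
        omega
      rw [mul_mul_mul_comm, weight, mul_assoc]
    · simp
  have half : (2 : ℂ) ^ η = 2 * 2 ^ (η - 1) := by rw [← pow_succ', Nat.sub_add_cancel hη]
  rw [linear, offdiag, half] at square
  rw [Nat.cast_sub (Nat.one_le_pow η 4 (by norm_num))]
  push_cast
  linear_combination square / 4 + geometric / 12

/-- On the `η`-qubit register,
`(E + (1/2) I)² = ((4^η − 1)/12) I + ∑_{0 ≤ n < k ≤ η−1} 2^{n+k−1} Zₙ Z_k`. -/
theorem shifted_electric_field_squared_pauli_decomposition (η : ℕ) (hη : 1 ≤ η) :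
    (Eop η + (1 / 2 : ℂ) • (1 : Matrix (Fin (2 ^ η)) (Fin (2 ^ η)) ℂ)) ^ 2
      = (((4 ^ η - 1 : ℕ) : ℂ) / 12) • (1 : Matrix (Fin (2 ^ η)) (Fin (2 ^ η)) ℂ)
        + ∑ n : Fin η, ∑ k : Fin η,
            if n < k then ((2 : ℂ) ^ ((n : ℕ) + (k : ℕ) - 1)) • (Zbit η n * Zbit η k)
            else 0 := by
  ext i j
  simp only [Eop, Zbit, Matrix.diagonal_mul_diagonal, ← Matrix.diagonal_one,
    ← Matrix.diagonal_smul, Matrix.diagonal_add, Matrix.diagonal_pow]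
  rcases eq_or_ne i j with rfl | h
  · simpa [Matrix.sum_apply, apply_ite (fun M : Matrix _ _ ℂ => M i i)] using
      shifted_sq_eq_sum_sign_mul_sign η hη i
  · simp [Matrix.sum_apply, apply_ite (fun M : Matrix _ _ ℂ => M i j), h]
end

section
/- For every 0 ≤ j ≤ η−2 (with F_{η−1} interpreted as the identity), the CNOT fan-out operators satisfy F_{j+1} ∘ F_j = CNOT_{j,j+1} ∘ F_{j+1}. -/
/-- `CNOT_{i,j}` on bit strings `x ∈ (ZMod 2)^η`: replaces `x_j` by `x_j ⊕ x_i`. -/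
def cnotFun (η : ℕ) (i j : Fin η) (x : Fin η → ZMod 2) : Fin η → ZMod 2 :=
  Function.update x j (x j + x i)

/-- The CNOT fan-out `F_j := CNOT_{j,j+1} ∘ CNOT_{j,j+2} ∘ ⋯ ∘ CNOT_{j,η−1}` (for `j = η−1`
the list of factors is empty and `F_{η−1}` is the identity). -/
def fanout {η : ℕ} (j : Fin η) : (Fin η → ZMod 2) → (Fin η → ZMod 2) :=
  (((List.finRange η).filter (fun k => decide (j < k))).map (cnotFun η j)).foldr (· ∘ ·) id

theorem foldr_cnotFun_apply {η : ℕ} (i : Fin η) (l : List (Fin η)) (hl : l.Nodup) (hi : i ∉ l)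
    (x : Fin η → ZMod 2) (k : Fin η) :
    (l.map (cnotFun η i)).foldr (· ∘ ·) id x k = if k ∈ l then x k + x i else x k := by
  induction l generalizing k with
  | nil => simp
  | cons a l ih =>
    obtain ⟨ha, hl⟩ := List.nodup_cons.mp hl
    have hil : i ∉ l := fun h => hi (List.mem_cons_of_mem a h)
    simp only [List.map_cons, List.foldr_cons, Function.comp_apply, cnotFun, Function.update_apply,
      ih hl hil, List.mem_cons]
    by_cases hk : k = a
    · subst hk
      simp [ha, hil]
    · simp [hk]

theorem fanout_apply {η : ℕ} (j : Fin η) (x : Fin η → ZMod 2) (k : Fin η) :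
    fanout j x k = if j < k then x k + x j else x k := by
  simp [fanout, foldr_cnotFun_apply j _ ((List.nodup_finRange η).filter _)]

/-- For every `0 ≤ j ≤ η−2` (with `F_{η−1}` the identity), the CNOT
fan-out operators satisfy `F_{j+1} ∘ F_j = CNOT_{j,j+1} ∘ F_{j+1}`. -/
theorem fanout_composition (η : ℕ) (hη : 2 ≤ η) (j : ℕ) (hj : j ≤ η - 2) :
    fanout (⟨j + 1, by omega⟩ : Fin η) ∘ fanout (⟨j, by omega⟩ : Fin η)
      = cnotFun η ⟨j, by omega⟩ ⟨j + 1, by omega⟩ ∘ fanout (⟨j + 1, by omega⟩ : Fin η) := by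
  funext x k
  simp only [Function.comp_apply, cnotFun, Function.update_apply, fanout_apply, Fin.lt_def,
    Fin.ext_iff]
  rcases lt_trichotomy (k : ℕ) (j + 1) with h | h | h
  · simp [show ¬ j + 1 < (k : ℕ) by omega, show ¬ j < (k : ℕ) by omega, h.ne]
  · have hk : k = ⟨j + 1, by omega⟩ := Fin.ext h
    simp [hk]
  · simp only [h, h.ne', show j < (k : ℕ) by omega, Nat.lt_succ_self, if_true, if_false]
    linear_combination CharTwo.add_self_eq_zero (x ⟨j, by omega⟩)
end

section
/- On ℂ^{2Λ}, the link operator combinations decompose into two-dimensional block-mixing pieces: U + U† = A + U† A U and i·(U − U†) = B + U† B U, where A|j⟩ = |j XOR 1⟩ and B|j⟩ = i·(−1)^j·|j XOR 1⟩. -/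
open Matrix Complex

lemma conj_Uop_apply (η : ℕ) (M : Matrix (Fin (2 ^ η)) (Fin (2 ^ η)) ℂ) (j k : Fin (2 ^ η)) :
    ((Uop η)ᴴ * M * Uop η) j k =
      M ⟨((j : ℕ) + 1) % 2 ^ η, Nat.mod_lt _ (by positivity)⟩
        ⟨((k : ℕ) + 1) % 2 ^ η, Nat.mod_lt _ (by positivity)⟩ := by
  have h (l i : Fin (2 ^ η)) : Uop η l i =
      if l = ⟨((i : ℕ) + 1) % 2 ^ η, Nat.mod_lt _ (by positivity)⟩ then 1 else 0 := by
    simp [Uop, Fin.ext_iff]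
  simp [Matrix.mul_apply, h, apply_ite]

lemma xor_one_eq_ite (k : ℕ) : k ^^^ 1 = if k % 2 = 0 then k + 1 else k - 1 := by
  split_ifs with h
  · exact Nat.xor_one_of_even (Nat.even_iff.mpr h)
  · exact Nat.xor_one_of_odd (Nat.odd_iff.mpr (by omega))

lemma succ_mod_eq_ite {j n : ℕ} (h : j < n) : (j + 1) % n = if j + 1 = n then 0 else j + 1 := by
  split_ifs with h'
  · simp [h']
  · exact Nat.mod_eq_of_lt (by omega)

lemma neg_one_pow_eq_ite_mod_two (k : ℕ) : (-1 : ℂ) ^ k = if k % 2 = 0 then 1 else -1 := by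
  split_ifs with h
  · exact (Nat.even_iff.mpr h).neg_one_pow
  · exact (Nat.odd_iff.mpr (by omega)).neg_one_pow

/-- On `ℂ^{2Λ}` (`2Λ = 2^η`), the link operator combinations decompose
into two-dimensional block-mixing pieces: `U + U† = A + U† A U` and
`i (U − U†) = B + U† B U`. -/
theorem link_operator_block_decomposition (η : ℕ) (hη : 1 ≤ η) :
    Uop η + (Uop η)ᴴ = Aop η + (Uop η)ᴴ * Aop η * Uop η ∧
      Complex.I • (Uop η - (Uop η)ᴴ) = Bop η + (Uop η)ᴴ * Bop η * Uop η := by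
  obtain ⟨m, hm⟩ : 2 ∣ 2 ^ η := dvd_pow_self 2 (by omega)
  constructor <;> ext ⟨j, hj⟩ ⟨k, hk⟩
  · rw [Matrix.add_apply, Matrix.add_apply, conj_Uop_apply]
    simp only [Matrix.conjTranspose_apply, Uop, Aop,
      Matrix.of_apply, xor_one_eq_ite, succ_mod_eq_ite hj, succ_mod_eq_ite hk, apply_ite star,
      star_one, star_zero]
    grind
  · rw [Matrix.add_apply, conj_Uop_apply]
    simp only [Matrix.sub_apply, Matrix.smul_apply, smul_eq_mul,
      Matrix.conjTranspose_apply, Uop, Bop, Matrix.of_apply, xor_one_eq_ite,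
      succ_mod_eq_ite hj, succ_mod_eq_ite hk, apply_ite star, star_one, star_zero,
      neg_one_pow_eq_ite_mod_two]
    grind
end
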